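/- Let p be a prime and s, n positive integers with s ∣ n. Let u, d be positive integers such that u ≡ p^{j₀} (mod p^s − 1) for some 0 ≤ j₀ ≤ s−1, gcd(u, p^n − 1) = 1, and d·u ≡ 1 (mod p^n − 1). Let ∘ be a presemifield multiplication on L admitting a dual ⋆ that is right K-linear. Let α ∈ L with α ≠ 0 and i₀ ∈ K, and let a : L × L → L satisfy a(0,y) = 0 for all y ∈ L and a(x,y) ∘ x^u = y for all x ∈ L \ {0} and y ∈ L. Define F : L × L → K by F(x,y) = Tr^n_s(α·a(x,y)) + i₀·(1 − x^{p^n − 1}) (this value lies in K). Then F is a vectorial dual-bent function satisfying Condition A with ε = 1: there exists F* : L × L → K such that for every c ∈ K \ {0} and every (w,v) ∈ L × L, W_{F_c}(w,v) = p^n·ζ_p^{Tr^s_1(c·F*(w,v))}. -/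

import Mathlib

open Finset

/-- `ζ_p^t = exp(2πi·t.val/p)` for `t : ZMod p`. -/
noncomputable def zetaP (p : ℕ) (t : ZMod p) : ℂ :=
  Complex.exp (2 * Real.pi * Complex.I * (t.val : ℂ) / (p : ℂ))

noncomputable instance (p n : ℕ) [Fact p.Prime] : Fintype (GaloisField p n) :=
  Fintype.ofFinite _

/-- The absolute trace of `GaloisField p n` down to `ZMod p`. -/
noncomputable def absTr (p n : ℕ) [Fact p.Prime] (x : GaloisField p n) : ZMod p :=
  Algebra.trace (ZMod p) (GaloisField p n) x

/-- The relative trace to the `p^s`-element subfield of `GaloisField p n`,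
`x ↦ ∑_{j=0}^{n/s−1} x^{(p^s)^j}`, as an element of `GaloisField p n`. -/
noncomputable def relTr (p n s : ℕ) [Fact p.Prime] (x : GaloisField p n) : GaloisField p n :=
  ∑ j ∈ Finset.range (n / s), x ^ (p ^ s) ^ j

theorem zetaP_eq_stdAddChar (p : ℕ) [NeZero p] (t : ZMod p) :
    zetaP p t = ZMod.stdAddChar t := by
  rw [ZMod.stdAddChar_apply, ZMod.toCircle_apply, zetaP]

theorem zetaP_add (p : ℕ) [NeZero p] (a b : ZMod p) :
    zetaP p (a + b) = zetaP p a * zetaP p b := by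
  simp only [zetaP_eq_stdAddChar, AddChar.map_add_eq_mul]

theorem absTr_add (p n : ℕ) [Fact p.Prime] (x y : GaloisField p n) :
    absTr p n (x + y) = absTr p n x + absTr p n y := by
  simp [absTr]

theorem absTr_sub (p n : ℕ) [Fact p.Prime] (x y : GaloisField p n) :
    absTr p n (x - y) = absTr p n x - absTr p n y := by
  simp [absTr]

theorem absTr_zero (p n : ℕ) [Fact p.Prime] : absTr p n 0 = 0 := by
  simp [absTr]

/-- The absolute trace form is nondegenerate. -/
theorem eq_zero_of_forall_absTr_mul_eq_zero (p n : ℕ) [Fact p.Prime] {a : GaloisField p n}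
    (h : ∀ b, absTr p n (a * b) = 0) : a = 0 :=
  (traceForm_nondegenerate (ZMod p) (GaloisField p n)).1 a h

theorem fintype_card_galoisField (p : ℕ) [Fact p.Prime] {n : ℕ} (hn : n ≠ 0) :
    Fintype.card (GaloisField p n) = p ^ n := by
  rw [← Nat.card_eq_fintype_card, GaloisField.card p n hn]

/-- Orthogonality of the additive characters of a Galois field. -/
theorem sum_zetaP_absTr_mul (p : ℕ) [Fact p.Prime] {n : ℕ} (hn : n ≠ 0) (b : GaloisField p n)
    [Decidable (b = 0)] :
    ∑ z, zetaP p (absTr p n (z * b)) = if b = 0 then (p : ℂ) ^ n else 0 := by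
  classical
  let ψ : AddChar (GaloisField p n) ℂ :=
    (ZMod.stdAddChar (N := p)).compAddMonoidHom
      (Algebra.trace (ZMod p) (GaloisField p n)).toAddMonoidHom
  have hψ (x) : ψ x = zetaP p (absTr p n x) := (zetaP_eq_stdAddChar p _).symm
  have hprim : ψ.IsPrimitive := by
    refine .of_ne_one fun h ↦ one_ne_zero (α := GaloisField p n) ?_
    refine eq_zero_of_forall_absTr_mul_eq_zero p n fun b ↦ ?_
    have hb : ψ b = 1 := by rw [h, AddChar.one_apply]
    rw [hψ, zetaP_eq_stdAddChar, ← (ZMod.stdAddChar (N := p)).map_zero_eq_one,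
      ZMod.injective_stdAddChar.eq_iff] at hb
    rwa [one_mul]
  simp_rw [← hψ]
  rw [AddChar.sum_mulShift b hprim, fintype_card_galoisField p hn]
  push_cast
  rfl

/-- The absolute trace is invariant under the Frobenius automorphisms. -/
theorem absTr_pow_pow (p n : ℕ) [Fact p.Prime] (x : GaloisField p n) (j : ℕ) :
    absTr p n (x ^ p ^ j) = absTr p n x := by
  induction j with
  | zero => simp
  | succ j ih =>
    rw [pow_succ, pow_mul, ← ih]
    have h := Algebra.trace_eq_of_algEquiv
      (FiniteField.frobeniusAlgEquivOfAlgebraic (ZMod p) (GaloisField p n)) (x ^ p ^ j)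
    simpa [absTr, ZMod.card] using h

/-- The relative trace takes values in the subfield and is transitive. -/
theorem exists_relTr_eq (p : ℕ) [Fact p.Prime] {n s : ℕ} (hn : n ≠ 0) (hs : s ≠ 0)
    (ι : GaloisField p s →+* GaloisField p n) (x : GaloisField p n) :
    ∃ t, ι t = relTr p n s x ∧ ∀ c, absTr p s (c * t) = absTr p n (ι c * x) := by
  let := ι.toAlgebra
  have : IsScalarTower (ZMod p) (GaloisField p s) (GaloisField p n) :=
    .of_algebraMap_eq' (Subsingleton.elim _ _)
  have hfin : Module.finrank (GaloisField p s) (GaloisField p n) = n / s := by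
    have h := Module.finrank_mul_finrank (ZMod p) (GaloisField p s) (GaloisField p n)
    rw [GaloisField.finrank p hn, GaloisField.finrank p hs] at h
    exact Nat.eq_div_of_mul_eq_right hs h
  refine ⟨Algebra.trace (GaloisField p s) (GaloisField p n) x, ?_, fun c ↦ ?_⟩
  · have h := FiniteField.algebraMap_trace_eq_sum_pow (GaloisField p s) (GaloisField p n) x
    rw [hfin, GaloisField.card p s hs] at h
    exact h
  · have h : c * Algebra.trace (GaloisField p s) (GaloisField p n) x =
        Algebra.trace (GaloisField p s) (GaloisField p n) (ι c * x) := by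
      rw [← smul_eq_mul, ← map_smul, Algebra.smul_def]
      rfl
    rw [h]
    exact Algebra.trace_trace _

theorem pow_eq_pow_of_modEq_card_sub_one (p : ℕ) [Fact p.Prime] {n : ℕ} (hn : n ≠ 0) {k l : ℕ}
    (hk : k ≠ 0) (hl : l ≠ 0) (h : k ≡ l [MOD p ^ n - 1]) (x : GaloisField p n) :
    x ^ k = x ^ l := by
  rcases eq_or_ne x 0 with rfl | hx
  · rw [zero_pow hk, zero_pow hl]
  · refine pow_eq_pow_of_modEq h ?_
    rw [← fintype_card_galoisField p hn, FiniteField.pow_card_sub_one_eq_one x hx]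

theorem stmt4 (p : ℕ) [Fact p.Prime] (n s : ℕ) (hn : 0 < n) (hs : 0 < s) (hsn : s ∣ n)
    (u d : ℕ) (hu : 0 < u) (hd : 0 < d)
    (j₀ : ℕ) (hj₀ : j₀ < s) (hmod : u ≡ p ^ j₀ [MOD p ^ s - 1])
    (hgcd : Nat.gcd u (p ^ n - 1) = 1) (hdu : d * u ≡ 1 [MOD p ^ n - 1])
    -- a presemifield multiplication `∘` on `L = GaloisField p n`
    (mul : GaloisField p n → GaloisField p n → GaloisField p n)
    (hmul_addl : ∀ x y z, mul (x + y) z = mul x z + mul y z)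
    (hmul_addr : ∀ x y z, mul z (x + y) = mul z x + mul z y)
    (hmul_zero : ∀ x y, mul x y = 0 → x = 0 ∨ y = 0)
    -- a dual `⋆` of `∘`
    (str : GaloisField p n → GaloisField p n → GaloisField p n)
    (hdual : ∀ x y z, absTr p n (z * mul x y) = absTr p n (x * str z y))
    -- the subfield `K` with `p^s` elements, realized via a ring embedding
    (ι : GaloisField p s →+* GaloisField p n)
    -- `⋆` is right `K`-linear
    (hlin : ∀ (x y : GaloisField p n) (c : GaloisField p s),
      str x (ι c * y) = ι c * str x y)
    (α : GaloisField p n) (hα : α ≠ 0) (i₀ : GaloisField p s)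
    -- the function `a(x,y)` with `a(0,y) = 0` and `a(x,y) ∘ x^u = y` for `x ≠ 0`
    (a : GaloisField p n → GaloisField p n → GaloisField p n)
    (ha0 : ∀ y, a 0 y = 0)
    (ha : ∀ x y, x ≠ 0 → mul (a x y) (x ^ u) = y)
    -- `F(x,y) = Tr^n_s(α·a(x,y)) + i₀·(1 − x^{p^n−1})`, a `K`-valued function
    (F : GaloisField p n → GaloisField p n → GaloisField p s)
    (hF : ∀ x y, ι (F x y) = relTr p n s (α * a x y) + ι i₀ * (1 - x ^ (p ^ n - 1))) :
    -- `F` is vectorial dual-bent satisfying Condition A with `ε = 1`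
    ∃ Fd : GaloisField p n → GaloisField p n → GaloisField p s,
      ∀ c : GaloisField p s, c ≠ 0 → ∀ w v : GaloisField p n,
        (∑ x : GaloisField p n, ∑ y : GaloisField p n,
            zetaP p (absTr p s (c * F x y) - absTr p n (w * x + v * y))) =
          (p : ℂ) ^ n * zetaP p (absTr p s (c * Fd w v)) := by
  classical
  have hn0 : n ≠ 0 := hn.ne'
  have hs0 : s ≠ 0 := hs.ne'
  choose Tr hTr_coe hTr using exists_relTr_eq p hn0 hs0 ι
  -- powers by `u` and `d` are mutually inverse
  have hpow (x : GaloisField p n) : x ^ (d * u) = x := by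
    simpa using pow_eq_pow_of_modEq_card_sub_one p hn0 (Nat.mul_pos hd hu).ne' one_ne_zero hdu x
  have hud (x : GaloisField p n) : (x ^ u) ^ d = x := by rw [← pow_mul, mul_comm, hpow]
  have hdu' (x : GaloisField p n) : (x ^ d) ^ u = x := by rw [← pow_mul, hpow]
  have hcpow (c : GaloisField p s) : (c ^ d) ^ p ^ j₀ = c := by
    rw [← pow_eq_pow_of_modEq_card_sub_one p hs0 hu.ne'
      (pow_ne_zero _ (Fact.out : p.Prime).ne_zero) hmod]
    exact ι.injective (by rw [map_pow, map_pow, hdu'])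
  -- bijectivity of the multiplication and its dual
  have hmul_bij (y) (hy : y ≠ 0) : Function.Bijective (mul · y) := by
    let f : GaloisField p n →+ GaloisField p n := AddMonoidHom.mk' (mul · y) (hmul_addl · · y)
    refine Finite.injective_iff_bijective.mp ((injective_iff_map_eq_zero f).mpr fun x hx ↦ ?_)
    exact (hmul_zero x y hx).resolve_right hy
  have hstr_zero_left (y) : str 0 y = 0 := by
    refine eq_zero_of_forall_absTr_mul_eq_zero p n fun x ↦ ?_
    rw [mul_comm, ← hdual, zero_mul, absTr_zero]
  have hstr_add (v y z) : str v (y + z) = str v y + str v z := by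
    refine sub_eq_zero.mp (eq_zero_of_forall_absTr_mul_eq_zero p n fun x ↦ ?_)
    rw [mul_comm, mul_sub, mul_add, absTr_sub, absTr_add, ← hdual, ← hdual, ← hdual, hmul_addr,
      mul_add, absTr_add, sub_self]
  have hstr_bij (v) (hv : v ≠ 0) : Function.Bijective (str v) := by
    let f : GaloisField p n →+ GaloisField p n := AddMonoidHom.mk' (str v) (hstr_add v)
    refine Finite.injective_iff_bijective.mp ((injective_iff_map_eq_zero f).mpr fun y hy ↦ ?_)
    replace hy : str v y = 0 := hy
    by_contra hy0
    refine hv (eq_zero_of_forall_absTr_mul_eq_zero p n fun t ↦ ?_)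
    obtain ⟨x, rfl⟩ := (hmul_bij y hy0).2 t
    rw [hdual, hy, mul_zero, absTr_zero]
  -- values of `F`
  have hF_zero (y) : F 0 y = i₀ := by
    apply ι.injective
    have hcard : p ^ n - 1 ≠ 0 :=
      (Nat.sub_pos_of_lt (Nat.one_lt_pow hn0 (Fact.out : p.Prime).one_lt)).ne'
    rw [hF, ha0, ← hTr_coe, zero_pow hcard, sub_zero, mul_one, add_eq_right, mul_zero, hTr_coe,
      relTr]
    exact Finset.sum_eq_zero fun j _ ↦
      zero_pow (pow_ne_zero _ (pow_ne_zero _ (Fact.out : p.Prime).ne_zero))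
  have hF_ne (x y) (hx : x ≠ 0) : F x y = Tr (α * a x y) := by
    apply ι.injective
    rw [hF, hTr_coe, ← fintype_card_galoisField p hn0, FiniteField.pow_card_sub_one_eq_one x hx,
      sub_self, mul_zero, add_zero]
  -- the inner sums of the Walsh transform
  have hinner_zero (c w v) :
      ∑ y, zetaP p (absTr p s (c * F 0 y) - absTr p n (w * 0 + v * y)) =
        if v = 0 then (p : ℂ) ^ n * zetaP p (absTr p s (c * i₀)) else 0 := by
    have h (y) : zetaP p (absTr p s (c * F 0 y) - absTr p n (w * 0 + v * y)) =
        zetaP p (absTr p s (c * i₀)) * zetaP p (absTr p n (y * -v)) := by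
      rw [← zetaP_add, hF_zero, sub_eq_add_neg, mul_zero, zero_add, mul_neg, mul_comm v,
        ← zero_sub (y * v), absTr_sub, absTr_zero, zero_sub]
    simp_rw [h]
    rw [← Finset.mul_sum, sum_zetaP_absTr_mul p hn0]
    simp [mul_comm]
  have hinner_ne (c w v x) (hx : x ≠ 0) :
      ∑ y, zetaP p (absTr p s (c * F x y) - absTr p n (w * x + v * y)) =
        if str v (x ^ u) = ι c * α then (p : ℂ) ^ n * zetaP p (absTr p n (-(w * x))) else 0 := by
    have hxu : x ^ u ≠ 0 := pow_ne_zero _ hx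
    have hsum := (hmul_bij _ hxu).sum_comp
      fun y ↦ zetaP p (absTr p s (c * F x y) - absTr p n (w * x + v * y))
    have h (z) : zetaP p (absTr p s (c * F x (mul z (x ^ u))) -
          absTr p n (w * x + v * mul z (x ^ u))) =
        zetaP p (absTr p n (-(w * x))) *
          zetaP p (absTr p n (z * (ι c * α - str v (x ^ u)))) := by
      have hz : a x (mul z (x ^ u)) = z := (hmul_bij _ hxu).1 (ha x _ hx)
      rw [← zetaP_add, hF_ne _ _ hx, hz, hTr, absTr_add, hdual, mul_sub, absTr_sub,
        ← zero_sub (w * x), absTr_sub, absTr_zero, ← mul_assoc, mul_comm _ z]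
      congr 1
      ring
    rw [← hsum]
    simp_rw [h]
    rw [← Finset.mul_sum, sum_zetaP_absTr_mul p hn0, mul_ite, mul_zero, mul_comm (zetaP _ _)]
    simp only [sub_eq_zero, eq_comm (a := ι c * α)]
  have hcα (c) (hc : c ≠ 0) : ι c * α ≠ 0 := mul_ne_zero ((map_ne_zero ι).mpr hc) hα
  have hsol (v) : ∃ b, v ≠ 0 → str v b = α := by
    by_cases hv : v = 0
    · exact ⟨0, fun h ↦ absurd hv h⟩
    · exact ((hstr_bij v hv).2 α).imp fun _ h _ ↦ h
  choose b hb using hsol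
  refine ⟨fun w v ↦ if v = 0 then i₀ else Tr (-(w * b v ^ d)) ^ p ^ j₀, fun c hc w v ↦ ?_⟩
  by_cases hv : v = 0
  · subst hv
    rw [Finset.sum_eq_single 0 _ (by simp), hinner_zero, if_pos rfl]
    · simp only [if_true]
    · intro x _ hx
      rw [hinner_ne c w 0 x hx, hstr_zero_left, if_neg (hcα c hc).symm]
  · have hstr_zero : str v 0 = 0 := by simpa using hstr_add v 0 0
    have hsolution : str v (ι c * b v) = ι c * α := by rw [hlin, hb v hv]
    have hx₀ : (ι c * b v) ^ d ≠ 0 := by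
      refine pow_ne_zero _ fun h ↦ hcα c hc ?_
      rw [← hsolution, h, hstr_zero]
    rw [Finset.sum_eq_single ((ι c * b v) ^ d) _ (by simp), hinner_ne c w v _ hx₀, hdu',
      if_pos hsolution]
    · simp only [if_neg hv]
      rw [show -(w * (ι c * b v) ^ d) = ι (c ^ d) * -(w * b v ^ d) by rw [map_pow]; ring, ← hTr,
        ← absTr_pow_pow p s _ j₀, mul_pow, hcpow]
    · intro x _ hx
      rcases eq_or_ne x 0 with rfl | hx0
      · rw [hinner_zero, if_neg hv]
      · rw [hinner_ne c w v x hx0, if_neg]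
        intro h
        refine hx ?_
        rw [← (hstr_bij v hv).1 (h.trans hsolution.symm), hud]
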